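/- (Gautschi's inequality, as used in the paper) For every real number q with 0 < q ≤ 1 and every real number x ≥ 0, one has 1/(x+1)^{1-q} ≤ Γ(x+q)/Γ(x+1) ≤ 1/(x + q/2)^{1-q}, where Γ denotes the real Gamma function. -/

import Mathlib

open Filter Topology

theorem Real.Gamma_add_le_rpow_mul_Gamma {y t : ℝ} (hy : 0 < y) (ht0 : 0 ≤ t) (ht1 : t ≤ 1) :
    Real.Gamma (y + t) ≤ y ^ t * Real.Gamma y := by
  rcases ht0.eq_or_lt with rfl | ht0
  · simp
  rcases ht1.eq_or_lt with rfl | ht1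
  · simp [Real.Gamma_add_one hy.ne']
  have hΓ := Real.Gamma_pos_of_pos hy
  have h := Real.Gamma_mul_add_mul_le_rpow_Gamma_mul_rpow_Gamma hy (by linarith : 0 < y + 1)
    (sub_pos.2 ht1) ht0 (by ring)
  calc Real.Gamma (y + t) = Real.Gamma ((1 - t) * y + t * (y + 1)) := by ring_nf
    _ ≤ Real.Gamma y ^ (1 - t) * Real.Gamma (y + 1) ^ t := h
    _ = y ^ t * (Real.Gamma y ^ (1 - t) * Real.Gamma y ^ t) := by
      rw [Real.Gamma_add_one hy.ne', Real.mul_rpow hy.le hΓ.le]; ring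
    _ = y ^ t * Real.Gamma y := by rw [← Real.rpow_add hΓ]; simp

theorem Real.log_one_add_mul_sub_log_one_sub_mul_le {v t : ℝ} (hv0 : 0 ≤ v) (hv1 : v < 1)
    (ht0 : 0 ≤ t) (ht1 : t ≤ 1) :
    Real.log (1 + t * v) - Real.log (1 - t * v) ≤
      t * (Real.log (1 + v) - Real.log (1 - v)) := by
  have htv : t * v ≤ v := mul_le_of_le_one_left hv0 ht1
  have h₁ := Real.hasSum_log_sub_log_of_abs_lt_one (x := t * v)
    (by rw [abs_of_nonneg (by positivity)]; linarith)
  have h₂ := (Real.hasSum_log_sub_log_of_abs_lt_one (x := v)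
    (by rwa [abs_of_nonneg hv0])).mul_left t
  refine hasSum_le (fun k => ?_) h₁ h₂
  have hpow : t ^ (2 * k + 1) ≤ t := pow_le_of_le_one ht0 ht1 (by simp)
  have hnn : 0 ≤ 2 * (1 / (2 * (k : ℝ) + 1)) * v ^ (2 * k + 1) := by positivity
  rw [mul_pow]
  linarith [mul_le_mul_of_nonneg_right hpow hnn]

theorem add_one_div_add_le_rpow {q x : ℝ} (hq0 : 0 < q) (hq1 : q ≤ 1) (hx : 0 ≤ x) :
    (x + 1) / (x + q) ≤ ((x + 1 + q / 2) / (x + q / 2)) ^ (1 - q) := by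
  have hm : 0 < 2 * x + 1 + q := by positivity
  have hv1 : 1 / (2 * x + 1 + q) < 1 := by rw [div_lt_one hm]; linarith
  have htv : (1 - q) * (1 / (2 * x + 1 + q)) < 1 :=
    (mul_le_of_le_one_left (by positivity) (by linarith)).trans_lt hv1
  have htv0 : 0 ≤ (1 - q) * (1 / (2 * x + 1 + q)) :=
    mul_nonneg (by linarith) (by positivity)
  have hv0 : 0 < 1 / (2 * x + 1 + q) := by positivity
  have h := Real.log_one_add_mul_sub_log_one_sub_mul_le hv0.le hv1
    (by linarith : 0 ≤ 1 - q) (by linarith)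
  rw [← Real.log_div (by linarith) (by linarith), ← Real.log_div (by linarith) (by linarith)] at h
  have e₁ : (1 + (1 - q) * (1 / (2 * x + 1 + q))) / (1 - (1 - q) * (1 / (2 * x + 1 + q))) =
      (x + 1) / (x + q) := by
    rw [div_eq_div_iff (by linarith) (by positivity)]
    field_simp
    ring
  have e₂ : (1 + 1 / (2 * x + 1 + q)) / (1 - 1 / (2 * x + 1 + q)) =
      (x + 1 + q / 2) / (x + q / 2) := by
    rw [div_eq_div_iff (by linarith) (by positivity)]
    field_simp
    ring
  rw [e₁, e₂] at h
  rw [← Real.log_le_log_iff (by positivity) (by positivity), Real.log_rpow (by positivity)]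
  exact h

theorem rpow_mul_Gamma_div_Gamma_le_succ {q x : ℝ} (hq0 : 0 < q) (hq1 : q ≤ 1) (hx : 0 ≤ x) :
    (x + q / 2) ^ (1 - q) * (Real.Gamma (x + q) / Real.Gamma (x + 1)) ≤
      (x + 1 + q / 2) ^ (1 - q) * (Real.Gamma (x + 1 + q) / Real.Gamma (x + 1 + 1)) := by
  have h := add_one_div_add_le_rpow hq0 hq1 hx
  have hG₁ := Real.Gamma_pos_of_pos (by positivity : 0 < x + q)
  have hG₂ := Real.Gamma_pos_of_pos (by positivity : 0 < x + 1)
  rw [Real.div_rpow (by positivity) (by positivity),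
    div_le_div_iff₀ (by positivity) (by positivity)] at h
  rw [show x + 1 + q = x + q + 1 by ring, Real.Gamma_add_one (by positivity : x + q ≠ 0),
    Real.Gamma_add_one (by positivity : x + 1 ≠ 0), ← mul_div_assoc, ← mul_div_assoc,
    div_le_div_iff₀ (by positivity) (by positivity)]
  linarith [mul_le_mul_of_nonneg_right h (mul_pos hG₁ hG₂).le]

theorem rpow_mul_Gamma_div_Gamma_le_rpow {q y : ℝ} (hq0 : 0 < q) (hq1 : q ≤ 1) (hy : 0 < y) :
    (y + q / 2) ^ (1 - q) * (Real.Gamma (y + q) / Real.Gamma (y + 1)) ≤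
      (1 + q / 2 / y) ^ (1 - q) := by
  have hΓ := Real.Gamma_pos_of_pos hy
  have h : Real.Gamma (y + q) / Real.Gamma (y + 1) ≤ 1 / y ^ (1 - q) := by
    rw [Real.Gamma_add_one hy.ne', div_le_div_iff₀ (by positivity) (by positivity)]
    calc Real.Gamma (y + q) * y ^ (1 - q) ≤ y ^ q * Real.Gamma y * y ^ (1 - q) := by
          gcongr; exact Real.Gamma_add_le_rpow_mul_Gamma hy hq0.le hq1
      _ = y ^ q * y ^ (1 - q) * Real.Gamma y := by ring
      _ = 1 * (y * Real.Gamma y) := by rw [← Real.rpow_add hy]; simp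
  calc _ ≤ (y + q / 2) ^ (1 - q) * (1 / y ^ (1 - q)) := by gcongr
    _ = ((y + q / 2) / y) ^ (1 - q) := by
      rw [Real.div_rpow (by positivity) hy.le, mul_one_div]
    _ = _ := by rw [add_div, div_self hy.ne']

theorem rpow_mul_Gamma_div_Gamma_le_one {q x : ℝ} (hq0 : 0 < q) (hq1 : q ≤ 1) (hx : 0 ≤ x) :
    (x + q / 2) ^ (1 - q) * (Real.Gamma (x + q) / Real.Gamma (x + 1)) ≤ 1 := by
  let g : ℝ → ℝ := fun y => (y + q / 2) ^ (1 - q) * (Real.Gamma (y + q) / Real.Gamma (y + 1))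
  have hmono : Monotone fun n : ℕ => g (x + n) := monotone_nat_of_le_succ fun n => by
    have := rpow_mul_Gamma_div_Gamma_le_succ hq0 hq1 (by positivity : 0 ≤ x + n)
    simpa only [g, Nat.cast_succ, ← add_assoc] using this
  have hlim : Tendsto (fun n : ℕ => (1 + q / 2 / (x + n)) ^ (1 - q)) atTop (𝓝 1) := by
    have hdiv : Tendsto (fun n : ℕ => q / 2 / (x + n)) atTop (𝓝 0) :=
      (tendsto_atTop_add_const_left _ x tendsto_natCast_atTop_atTop).const_div_atTop _
    simpa using (hdiv.const_add 1).rpow_const (p := 1 - q) (Or.inl (by norm_num))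
  refine ge_of_tendsto hlim ?_
  filter_upwards [eventually_gt_atTop 0] with n hn
  have hn' : (0 : ℝ) < n := Nat.cast_pos.2 hn
  calc g x = g (x + (0 : ℕ)) := by simp
    _ ≤ g (x + n) := hmono n.zero_le
    _ ≤ _ := rpow_mul_Gamma_div_Gamma_le_rpow hq0 hq1 (by positivity)

/-- Gautschi's inequality, as used in the paper: for `0 < q ≤ 1` and `x ≥ 0`,
`1/(x+1)^(1-q) ≤ Γ(x+q)/Γ(x+1) ≤ 1/(x+q/2)^(1-q)`. -/
theorem gautschi_inequality (q x : ℝ) (hq0 : 0 < q) (hq1 : q ≤ 1) (hx : 0 ≤ x) :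
    1 / (x + 1) ^ (1 - q) ≤ Real.Gamma (x + q) / Real.Gamma (x + 1) ∧
      Real.Gamma (x + q) / Real.Gamma (x + 1) ≤ 1 / (x + q / 2) ^ (1 - q) := by
  have hG₁ := Real.Gamma_pos_of_pos (by positivity : 0 < x + q)
  have hG₂ := Real.Gamma_pos_of_pos (by positivity : 0 < x + 1)
  constructor
  · rw [div_le_div_iff₀ (by positivity) hG₂, one_mul, mul_comm]
    calc Real.Gamma (x + 1) = Real.Gamma (x + q + (1 - q)) := by ring_nf
      _ ≤ (x + q) ^ (1 - q) * Real.Gamma (x + q) :=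
        Real.Gamma_add_le_rpow_mul_Gamma (by positivity) (by linarith) (by linarith)
      _ ≤ (x + 1) ^ (1 - q) * Real.Gamma (x + q) := by
        gcongr
  · rw [le_div_iff₀ (by positivity), mul_comm]
    exact rpow_mul_Gamma_div_Gamma_le_one hq0 hq1 hx
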